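/- arXiv:2201.11952 — 3 statements merged into one kernel-verified Lean document; each statement's English description precedes it below -/
import Mathlib

section
/- Let G be a real m×n matrix, x ∈ ℝ^m, E a real l×n matrix, and d ∈ ℝ^l. Suppose the polyhedra P(G,x) := {p ∈ ℝ^n : Gp ≤ x} and P(E,d) := {p ∈ ℝ^n : Ep ≤ d} are both nonempty. Then P(G,x) ⊆ P(E,d) if and only if there exists a real l×m matrix F with all entries nonnegative such that FG = E and Fx ≤ d. -/
/-- Farkas' lemma for finitely many linear functionals on a vector space of arbitrary dimension. -/
theorem exists_nonneg_combination_of_nonpos {K V ι : Type*} [Field K] [LinearOrder K]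
    [IsStrictOrderedRing K] [AddCommGroup V] [Module K V] (s : Finset ι)
    (a : ι → V →ₗ[K] K) (b : V →ₗ[K] K)
    (h : ∀ v, (∀ i ∈ s, a i v ≤ 0) → b v ≤ 0) :
    ∃ u : ι → K, (∀ i, 0 ≤ u i) ∧ b = ∑ i ∈ s, u i • a i := by
  classical
  induction s using Finset.induction_on generalizing a b with
  | empty =>
    refine ⟨0, fun _ => le_rfl, ?_⟩
    ext v
    have h₁ := h v (by simp)
    have h₂ := h (-v) (by simp)
    rw [map_neg] at h₂
    simpa using le_antisymm h₁ (by linarith)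
  | insert k s hk ih =>
    by_cases hs : ∀ v, (∀ i ∈ s, a i v ≤ 0) → b v ≤ 0
    · obtain ⟨u, hu, hb⟩ := ih a b hs
      refine ⟨Function.update u k 0, fun i => ?_, ?_⟩
      · by_cases hi : i = k
        · simp [hi]
        · simpa [hi] using hu i
      · rw [Finset.sum_insert hk, Function.update_self, zero_smul, zero_add, hb]
        refine Finset.sum_congr rfl fun i hi => ?_
        rw [Function.update_of_ne (ne_of_mem_of_not_mem hi hk)]
    · push Not at hs
      obtain ⟨w, hw, hbw⟩ := hs
      have hkw : 0 < a k w := by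
        by_contra! hneg
        exact hbw.not_ge (h w (by simpa [hneg] using hw))
      -- Project along `w` onto the kernel of `a k`.
      obtain ⟨u, hu, hb⟩ := ih (fun i => a i - (a i w / a k w) • a k)
        (b - (b w / a k w) • a k) (fun v hv => by
          have hproj (f : V →ₗ[K] K) :
              (f - (f w / a k w) • a k) v = f (v - (a k v / a k w) • w) := by
            simp only [LinearMap.sub_apply, LinearMap.smul_apply, map_sub, map_smul, smul_eq_mul]
            ring
          rw [hproj]
          apply h
          intro i hi
          rcases Finset.mem_insert.1 hi with rfl | hi
          · simp [hkw.ne']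
          · rw [← hproj]
            exact hv i hi)
      refine ⟨Function.update u k ((b w - ∑ i ∈ s, u i * a i w) / a k w), fun i => ?_, ?_⟩
      · by_cases hi : i = k
        · subst hi
          rw [Function.update_self]
          have hsum : ∑ j ∈ s, u j * a j w ≤ 0 :=
            Finset.sum_nonpos fun j hj => mul_nonpos_of_nonneg_of_nonpos (hu j) (hw j hj)
          exact div_nonneg (by linarith) hkw.le
        · simpa [hi] using hu i
      · have hupd : ∑ i ∈ s, Function.update u k ((b w - ∑ i ∈ s, u i * a i w) / a k w) i • a i =
            ∑ i ∈ s, u i • a i :=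
          Finset.sum_congr rfl fun i hi => by
            rw [Function.update_of_ne (ne_of_mem_of_not_mem hi hk)]
        rw [Finset.sum_insert hk, Function.update_self, hupd]
        simp only [sub_eq_iff_eq_add, smul_sub, Finset.sum_sub_distrib, smul_smul,
          ← Finset.sum_smul] at hb
        simp only [sub_div, Finset.sum_div, mul_div_assoc]
        refine hb.trans ?_
        module

/-- The affine form of Farkas' lemma: an inequality `e ⬝ᵥ p ≤ c` valid on a nonempty polyhedron
`{p | G p ≤ x}` is dominated by a nonnegative combination of the defining inequalities. -/
theorem exists_nonneg_vecMul_eq_of_forall_dotProduct_le {K ι κ : Type*} [Field K] [LinearOrder K]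
    [IsStrictOrderedRing K] [Fintype ι] [Fintype κ] (G : Matrix ι κ K) (x : ι → K)
    (e : κ → K) (c : K) (hG : ∃ p, G.mulVec p ≤ x)
    (h : ∀ p, G.mulVec p ≤ x → dotProduct e p ≤ c) :
    ∃ u : ι → K, 0 ≤ u ∧ Matrix.vecMul u G = e ∧ dotProduct u x ≤ c := by
  classical
  let L (g : κ → K) (r : K) : (κ → K) × K →ₗ[K] K :=
    (dotProductBilin K K g).comp (LinearMap.fst K _ _) - r • LinearMap.snd K _ _
  have hL (g r p t) : L g r (p, t) = dotProduct g p - r * t := by simp [L]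
  obtain ⟨u, hu, hb⟩ := exists_nonneg_combination_of_nonpos Finset.univ
    (fun o : Option ι => o.elim (L 0 1) fun i => L (G i) (x i)) (L e c) (by
      rintro ⟨p, t⟩ hv
      have ht : 0 ≤ t := by simpa [hL] using hv none (Finset.mem_univ _)
      have hp (i) : dotProduct (G i) p ≤ x i * t := by
        simpa [hL] using hv (some i) (Finset.mem_univ _)
      rw [hL, sub_nonpos]
      rcases ht.eq_or_lt with rfl | ht
      · obtain ⟨q, hq⟩ := hG
        by_contra! hpos
        rw [mul_zero] at hpos
        have hmem (r : K) (hr : 0 ≤ r) : dotProduct e q + r * dotProduct e p ≤ c := by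
          have := h (q + r • p) fun i => by
            have h₁ : dotProduct (G i) q ≤ x i := hq i
            have h₂ := mul_nonpos_of_nonneg_of_nonpos hr (by simpa using hp i)
            simp only [Matrix.mulVec, dotProduct_add, dotProduct_smul, smul_eq_mul]
            linarith
          simpa [dotProduct_add] using this
        have hq' := hmem 0 le_rfl
        have := hmem ((c - dotProduct e q + 1) / dotProduct e p)
          (div_nonneg (by linarith) hpos.le)
        rw [div_mul_cancel₀ _ hpos.ne'] at this
        linarith
      · have := h (t⁻¹ • p) fun i => by
          simp only [Matrix.mulVec, dotProduct_smul, smul_eq_mul]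
          rw [inv_mul_le_iff₀ ht, mul_comm]
          exact hp i
        rw [dotProduct_smul, smul_eq_mul, inv_mul_le_iff₀ ht] at this
        linarith)
  have heval (p t) : dotProduct e p - c * t =
      -(u none * t) + ∑ i, u (some i) * (dotProduct (G i) p - x i * t) := by
    simpa [hL, Fintype.sum_option, LinearMap.sum_apply] using LinearMap.congr_fun hb (p, t)
  refine ⟨fun i => u (some i), fun i => hu _, ?_, ?_⟩
  · ext j
    have := heval (Pi.single j 1) 0
    simp only [dotProduct_single, mul_one, mul_zero, sub_zero, neg_zero, zero_add] at this
    exact this.symm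
  · have := heval 0 1
    simp only [dotProduct_zero, mul_one, zero_sub, mul_neg, Finset.sum_neg_distrib] at this
    have := hu none
    simp only [dotProduct]
    linarith

/-- Farkas' lemma on the containment of polyhedra: for nonempty polyhedra
`P(G,x) = {p : G p ≤ x}` and `P(E,d) = {p : E p ≤ d}`, containment holds
iff there is an entrywise-nonnegative matrix `F` with `F G = E` and `F x ≤ d`. -/
theorem farkas_polyhedron_containment
    (m n l : ℕ)
    (G : Matrix (Fin m) (Fin n) ℝ) (x : Fin m → ℝ)
    (E : Matrix (Fin l) (Fin n) ℝ) (d : Fin l → ℝ)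
    (hG : ∃ p : Fin n → ℝ, G.mulVec p ≤ x)
    (hE : ∃ p : Fin n → ℝ, E.mulVec p ≤ d) :
    {p : Fin n → ℝ | G.mulVec p ≤ x} ⊆ {p : Fin n → ℝ | E.mulVec p ≤ d} ↔
      ∃ F : Matrix (Fin l) (Fin m) ℝ,
        (∀ i j, 0 ≤ F i j) ∧ F * G = E ∧ F.mulVec x ≤ d := by
  constructor
  · intro h
    have hrow (i : Fin l) := exists_nonneg_vecMul_eq_of_forall_dotProduct_le G x (E i) (d i) hG
      fun p hp => h hp i
    choose F hF hFG hFx using hrow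
    exact ⟨F, hF, funext hFG, hFx⟩
  · rintro ⟨F, hF, rfl, hFx⟩ p hp
    refine le_trans ?_ hFx
    rw [← Matrix.mulVec_mulVec]
    intro i
    exact dotProduct_le_dotProduct_of_nonneg_left hp (hF i)
end

section
/- Let G be a real m×n matrix, E a real l×n matrix, d ∈ ℝ^l, x̄ ∈ ℝ^m, z ∈ ℝ^n, and β > 0. If there exists a real l×m matrix F with all entries nonnegative satisfying FG = E and Fx̄ ≤ Ez + βd, then {p ∈ ℝ^n : Gp ≤ β⁻¹(x̄ − Gz)} ⊆ {p ∈ ℝ^n : Ep ≤ d}. -/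
open Matrix

/-- Correctness of the LP reformulation of optimal flexibility design: a
nonnegative `F` with `F G = E` and `F x̄ ≤ E z + β d` certifies that
`{p : G p ≤ β⁻¹ (x̄ − G z)} ⊆ {p : E p ≤ d}`. -/
theorem lp_reformulation_containment
    (m n l : ℕ)
    (G : Matrix (Fin m) (Fin n) ℝ)
    (E : Matrix (Fin l) (Fin n) ℝ) (d : Fin l → ℝ)
    (xbar : Fin m → ℝ) (z : Fin n → ℝ) (β : ℝ) (hβ : 0 < β)
    (hF : ∃ F : Matrix (Fin l) (Fin m) ℝ,
      (∀ i j, 0 ≤ F i j) ∧ F * G = E ∧ F.mulVec xbar ≤ E.mulVec z + β • d) :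
    {p : Fin n → ℝ | G.mulVec p ≤ β⁻¹ • (xbar - G.mulVec z)} ⊆
      {p : Fin n → ℝ | E.mulVec p ≤ d} := by
  obtain ⟨F, hF_nonneg, rfl, hx⟩ := hF
  intro p hp i
  have hGp : (F *ᵥ (G *ᵥ p)) i ≤ (F *ᵥ (β⁻¹ • (xbar - G *ᵥ z))) i :=
    dotProduct_le_dotProduct_of_nonneg_left hp (hF_nonneg i)
  have hxi := hx i
  simp only [← mulVec_mulVec, Pi.add_apply, Pi.smul_apply, smul_eq_mul] at hxi
  rw [mulVec_smul, mulVec_sub, Pi.smul_apply, Pi.sub_apply, smul_eq_mul] at hGp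
  rw [← mulVec_mulVec]
  refine hGp.trans ?_
  rw [inv_mul_le_iff₀ hβ]
  linarith
end

section
/- Let G be a real m×n matrix, E a real l×n matrix, d ∈ ℝ^l, x̄ ∈ ℝ^m, z ∈ ℝ^n, β > 0, W a real symmetric n×n matrix, w₁ ∈ ℝ^n, and w₀ ∈ ℝ. Suppose: (i) there exists a real l×m matrix F with all entries nonnegative such that FG = E and Fx̄ ≤ Ez + βd, and (ii) every p ∈ ℝ^n with Ep ≤ d satisfies pᵀWp + w₁ᵀp + w₀ ≤ 0. Then every p ∈ ℝ^n with Gp ≤ β⁻¹(x̄ − Gz) satisfies pᵀWp + w₁ᵀp + w₀ ≤ 0. -/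
open Matrix

/-- Every schedule in the final polytope `{p : G p ≤ β⁻¹ (x̄ − G z)}` is
classified as disaggregatable by the convex quadratic classifier
`d(p) = pᵀ W p + w₁ᵀ p + w₀`, provided a nonnegative Farkas certificate `F`
exists and the inner polytope `{p : E p ≤ d}` lies in the classifier's
0-sublevel set. -/
theorem final_polytope_in_classifier_sublevel
    (m n l : ℕ)
    (G : Matrix (Fin m) (Fin n) ℝ)
    (E : Matrix (Fin l) (Fin n) ℝ) (d : Fin l → ℝ)
    (xbar : Fin m → ℝ) (z : Fin n → ℝ) (β : ℝ) (hβ : 0 < β)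
    (W : Matrix (Fin n) (Fin n) ℝ) (hW : W.IsSymm)
    (w₁ : Fin n → ℝ) (w₀ : ℝ)
    (hF : ∃ F : Matrix (Fin l) (Fin m) ℝ,
      (∀ i j, 0 ≤ F i j) ∧ F * G = E ∧ F.mulVec xbar ≤ E.mulVec z + β • d)
    (hclass : ∀ p : Fin n → ℝ, E.mulVec p ≤ d →
      p ⬝ᵥ W.mulVec p + w₁ ⬝ᵥ p + w₀ ≤ 0) :
    ∀ p : Fin n → ℝ, G.mulVec p ≤ β⁻¹ • (xbar - G.mulVec z) →
      p ⬝ᵥ W.mulVec p + w₁ ⬝ᵥ p + w₀ ≤ 0 := by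
  obtain ⟨F, hF0, rfl, hFx⟩ := hF
  intro p hp
  refine hclass p fun i => ?_
  calc ((F * G) *ᵥ p) i = (F *ᵥ (G *ᵥ p)) i := by rw [mulVec_mulVec]
    _ ≤ (F *ᵥ (β⁻¹ • (xbar - G *ᵥ z))) i :=
        dotProduct_le_dotProduct_of_nonneg_left hp (hF0 i)
    _ = β⁻¹ * ((F *ᵥ xbar) i - ((F * G) *ᵥ z) i) := by
        rw [mulVec_smul, mulVec_sub, mulVec_mulVec]
        rfl
    _ ≤ d i := by
        have h : (F *ᵥ xbar) i ≤ ((F * G) *ᵥ z) i + β * d i := hFx i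
        rw [inv_mul_le_iff₀ hβ]
        linarith
end
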